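/- Suppose K is an infinite field. With n_0 = 0 < n_1 < ... < n_{r_B} = t the greedy segmentation of B into almost rectangular segments, set μ̃_i = μ_{n_{i−1}+1} + ... + μ_{n_i} and B̃ = (μ̃_1,...,μ̃_{r_B}). If s_B = n_i − n_{i−1} for every i = 1,...,r_B, then Q(B) = B̃; that is, there exists A₀ ∈ N_B whose Jordan type is B̃, and every A ∈ N_B satisfies rank A^m ≤ rank J̃^m for all m ∈ ℕ, where J̃ is a nilpotent matrix of Jordan type B̃. -/

import Mathlib

open Matrix Finset

/-- The Jordan matrix of the partition `μ`. -/
def jordanMatrix (K : Type*) [Field K] (t : ℕ) (μ : Fin t → ℕ) :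
    Matrix (Σ i : Fin t, Fin (μ i)) (Σ i : Fin t, Fin (μ i)) K :=
  fun p q => if p.1 = q.1 ∧ (p.2 : ℕ) + 1 = (q.2 : ℕ) then 1 else 0

theorem Matrix.rank_le_card_of_rows {ι K : Type*} [Fintype ι] [DecidableEq ι] [Field K]
    (T : Matrix ι ι K) (P : Finset ι) (hT : ∀ p q, T p q ≠ 0 → p ∈ P) : T.rank ≤ #P := by
  have h : T = diagonal (fun p => if p ∈ P then (1 : K) else 0) * T := by
    ext p q
    rw [diagonal_mul]
    by_cases hp : p ∈ P
    · simp [hp]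
    · have : T p q = 0 := by
        by_contra h
        exact hp (hT p q h)
      simp [this]
  classical
  rw [h]
  refine (rank_mul_le_left _ _).trans ?_
  rw [rank_diagonal]
  simp

theorem Matrix.rank_le_card_add_card {ι K : Type*} [Fintype ι] [DecidableEq ι] [Field K]
    (T : Matrix ι ι K) (P Q : Finset ι) (hT : ∀ p q, T p q ≠ 0 → p ∈ P ∨ q ∈ Q) :
    T.rank ≤ #P + #Q := by
  have h : T = (Matrix.of fun p q => if p ∈ P then T p q else 0) +
      (Matrix.of fun p q => if p ∈ P then 0 else T p q) := by
    ext p q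
    by_cases hp : p ∈ P <;> simp [hp]
  rw [h]
  have hadd : ∀ M N : Matrix ι ι K, (M + N).rank ≤ M.rank + N.rank := fun M N => by
    have h := LinearMap.range_add_le M.mulVecLin N.mulVecLin
    rw [← mulVecLin_add] at h
    exact (Submodule.finrank_mono h).trans
      (Submodule.finrank_add_le_finrank_add_finrank _ _)
  refine (hadd _ _).trans (Nat.add_le_add ?_ ?_)
  · refine rank_le_card_of_rows _ _ fun p q hpq => ?_
    by_contra hp
    simp [hp] at hpq
  · rw [← rank_transpose]
    refine rank_le_card_of_rows _ _ fun q p hpq => ?_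
    by_cases hp : p ∈ P
    · simp [hp] at hpq
    · simp only [transpose_apply, of_apply, hp, if_false] at hpq
      exact (hT p q hpq).resolve_left hp

/-- The drops of the sequence of ranks of the powers of a matrix are nonincreasing. -/
theorem Matrix.rank_pow_convex {ι K : Type*} [Fintype ι] [DecidableEq ι] [Field K]
    (A : Matrix ι ι K) (m : ℕ) :
    2 * (A ^ (m + 1)).rank ≤ (A ^ m).rank + (A ^ (m + 2)).rank := by
  have key : ∀ n, (A ^ (n + 1)).rank +
      Module.finrank K ↥(LinearMap.range (A ^ n).mulVecLin ⊓ LinearMap.ker A.mulVecLin) =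
      (A ^ n).rank := by
    intro n
    have h := LinearMap.finrank_range_add_finrank_ker
      (A.mulVecLin.domRestrict (LinearMap.range (A ^ n).mulVecLin))
    rw [LinearMap.range_domRestrict, ← LinearMap.range_comp, ← mulVecLin_mul, ← pow_succ',
      LinearMap.ker_domRestrict] at h
    rw [Matrix.rank, Matrix.rank, ← h, ← Submodule.map_comap_subtype]
    congr 1
    exact (Submodule.equivMapOfInjective _ (Submodule.injective_subtype _) _).finrank_eq.symm
  have h1 := key m
  have h2 := key (m + 1)
  have h3 : Module.finrank K
      ↥(LinearMap.range (A ^ (m + 1)).mulVecLin ⊓ LinearMap.ker A.mulVecLin) ≤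
      Module.finrank K ↥(LinearMap.range (A ^ m).mulVecLin ⊓ LinearMap.ker A.mulVecLin) := by
    apply Submodule.finrank_mono
    refine inf_le_inf_right _ ?_
    rw [pow_succ, mulVecLin_mul]
    exact LinearMap.range_comp_le_range _ _
  rw [show m + 2 = m + 1 + 1 from rfl]
  omega

theorem Matrix.pow_card_eq_zero_of_isNilpotent {ι K : Type*} [Fintype ι] [DecidableEq ι] [Field K]
    {A : Matrix ι ι K} (hA : IsNilpotent A) : A ^ Fintype.card ι = 0 := by
  have h : IsNilpotent (Matrix.toLin' A) := by
    obtain ⟨k, hk⟩ := hA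
    exact ⟨k, by rw [← Matrix.toLin'_pow, hk, map_zero]⟩
  have h1 := (Matrix.toLin' A).aeval_self_charpoly
  rw [h.charpoly_eq_X_pow_finrank] at h1
  simp only [map_pow, Polynomial.aeval_X, Module.finrank_fintype_fun_eq_card] at h1
  rw [← Matrix.toLin'_pow] at h1
  exact (Matrix.toLin' (R := K) (m := ι) (n := ι)).map_eq_zero_iff.mp h1

/-- A nilpotent matrix supported on a preorder `R` restricts to a nilpotent matrix on each interval
of `R`. -/
theorem Matrix.pow_apply_eq_zero_of_card_interval_le {ι K : Type*} [Fintype ι] [DecidableEq ι]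
    [Field K] (R : ι → ι → Prop) [DecidableRel R] (hrefl : ∀ p, R p p)
    (htrans : ∀ p q u, R p q → R q u → R p u)
    {A : Matrix ι ι K} (hA : IsNilpotent A) (hAR : ∀ p q, A p q ≠ 0 → R p q)
    (p q : ι) (s : ℕ) (hcard : #{u | R p u ∧ R u q} ≤ s) : (A ^ s) p q = 0 := by
  have hpow : ∀ k u v, (A ^ k) u v ≠ 0 → R u v := by
    intro k
    induction k with
    | zero =>
      intro u v h
      by_cases huv : u = v
      · exact huv ▸ hrefl u
      · simp [huv] at h
    | succ k ih =>
      intro u v h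
      rw [pow_succ, mul_apply] at h
      obtain ⟨x, -, hx⟩ := exists_ne_zero_of_sum_ne_zero h
      exact htrans _ _ _ (ih _ _ (left_ne_zero_of_mul hx)) (hAR _ _ (right_ne_zero_of_mul hx))
  by_contra hne
  have hpq : R p q := hpow _ _ _ hne
  let S := {u // R p u ∧ R u q}
  let N : Matrix S S K := A.submatrix (↑) (↑)
  have hN : ∀ k, N ^ k = (A ^ k).submatrix (↑) (↑) := by
    intro k
    induction k with
    | zero => exact (submatrix_one _ Subtype.val_injective).symm
    | succ k ih =>
      ext u v
      rw [pow_succ, pow_succ, mul_apply, ih, submatrix_apply, mul_apply]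
      simp only [submatrix_apply, N]
      rw [← Finset.sum_subtype ({u | R p u ∧ R u q} : Finset ι) (by simp)
        (fun x => (A ^ k) u x * A x v)]
      refine Finset.sum_subset (subset_univ _) fun x _ hx => ?_
      by_contra h
      refine hx (mem_filter.mpr ⟨mem_univ _, ?_, ?_⟩)
      · exact htrans _ _ _ u.2.1 (hpow _ _ _ (left_ne_zero_of_mul h))
      · exact htrans _ _ _ (hAR _ _ (right_ne_zero_of_mul h)) v.2.2
  have hN0 : IsNilpotent N := by
    obtain ⟨k, hk⟩ := hA
    exact ⟨k, by rw [hN, hk]; rfl⟩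
  have hS : N ^ s = 0 := by
    refine pow_eq_zero_of_le ?_ (Matrix.pow_card_eq_zero_of_isNilpotent hN0)
    rwa [Fintype.card_subtype]
  have := congrFun (congrFun hS ⟨p, hrefl p, hpq⟩) ⟨q, hpq, hrefl q⟩
  rw [hN] at this
  exact hne this

section JordanMatrix

variable {K : Type*} [Field K] {t : ℕ} {μ : Fin t → ℕ}

theorem mul_jordanMatrix_zero (A : Matrix (Σ i : Fin t, Fin (μ i)) (Σ i : Fin t, Fin (μ i)) K)
    (p : Σ i : Fin t, Fin (μ i)) (j : Fin t) (h : 0 < μ j) :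
    (A * jordanMatrix K t μ) p ⟨j, 0, h⟩ = 0 := by
  rw [mul_apply]
  exact sum_eq_zero fun u _ => by simp [jordanMatrix]

theorem mul_jordanMatrix_succ (A : Matrix (Σ i : Fin t, Fin (μ i)) (Σ i : Fin t, Fin (μ i)) K)
    (p : Σ i : Fin t, Fin (μ i)) (j : Fin t) (b : ℕ) (h : b + 1 < μ j) :
    (A * jordanMatrix K t μ) p ⟨j, b + 1, h⟩ = A p ⟨j, b, by omega⟩ := by
  rw [mul_apply, sum_eq_single ⟨j, b, by omega⟩]
  · simp [jordanMatrix]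
  · rintro ⟨i, a⟩ - hne
    rw [jordanMatrix, if_neg, mul_zero]
    rintro ⟨rfl : i = j, h2⟩
    refine hne ?_
    congr 1
    ext
    simpa using h2
  · simp

theorem jordanMatrix_mul_last (A : Matrix (Σ i : Fin t, Fin (μ i)) (Σ i : Fin t, Fin (μ i)) K)
    (q : Σ i : Fin t, Fin (μ i)) (i : Fin t) (a : Fin (μ i)) (h : a + 1 = μ i) :
    (jordanMatrix K t μ * A) ⟨i, a⟩ q = 0 := by
  rw [mul_apply]
  refine sum_eq_zero fun u _ => ?_
  rw [jordanMatrix, if_neg, zero_mul]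
  obtain ⟨j, b⟩ := u
  rintro ⟨rfl : i = j, h2⟩
  have := b.2
  simp only at h2
  omega

theorem jordanMatrix_mul_of_lt (A : Matrix (Σ i : Fin t, Fin (μ i)) (Σ i : Fin t, Fin (μ i)) K)
    (q : Σ i : Fin t, Fin (μ i)) (i : Fin t) (a : ℕ) (h : a + 1 < μ i) :
    (jordanMatrix K t μ * A) ⟨i, a, by omega⟩ q = A ⟨i, a + 1, h⟩ q := by
  rw [mul_apply, sum_eq_single ⟨i, a + 1, h⟩]
  · simp [jordanMatrix]
  · rintro ⟨j, b⟩ - hne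
    rw [jordanMatrix, if_neg, zero_mul]
    rintro ⟨rfl : i = j, h2⟩
    refine hne ?_
    congr 1
    ext
    simpa using h2.symm
  · simp

theorem le_of_commute_jordanMatrix
    {A : Matrix (Σ i : Fin t, Fin (μ i)) (Σ i : Fin t, Fin (μ i)) K}
    (hA : A * jordanMatrix K t μ = jordanMatrix K t μ * A) (i j : Fin t) (b : ℕ) (hb : b < μ j) :
    ∀ (a : ℕ) (ha : a < μ i), A ⟨i, a, ha⟩ ⟨j, b, hb⟩ ≠ 0 → a ≤ b := by
  induction b with
  | zero =>
    intro a ha h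
    cases a with
    | zero => rfl
    | succ a =>
      rw [← jordanMatrix_mul_of_lt A _ i a ha, ← hA, mul_jordanMatrix_zero] at h
      exact absurd rfl h
  | succ b ih =>
    intro a ha h
    cases a with
    | zero => omega
    | succ a =>
      rw [← jordanMatrix_mul_of_lt A _ i a ha, ← hA, mul_jordanMatrix_succ] at h
      have := ih _ _ _ h
      omega

theorem add_le_add_of_commute_jordanMatrix
    {A : Matrix (Σ i : Fin t, Fin (μ i)) (Σ i : Fin t, Fin (μ i)) K}
    (hA : A * jordanMatrix K t μ = jordanMatrix K t μ * A) (i j : Fin t) (d : ℕ) :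
    ∀ (a b : ℕ) (ha : a < μ i) (hb : b < μ j), a + d + 1 = μ i →
      A ⟨i, a, ha⟩ ⟨j, b, hb⟩ ≠ 0 → μ j + a ≤ μ i + b := by
  induction d with
  | zero =>
    intro a b ha hb had h
    rcases Nat.lt_or_ge (b + 1) (μ j) with hb' | hb'
    · rw [← mul_jordanMatrix_succ A _ j b hb', hA, jordanMatrix_mul_last A _ i _ had] at h
      exact absurd rfl h
    · omega
  | succ d ih =>
    intro a b ha hb had h
    rcases Nat.lt_or_ge (b + 1) (μ j) with hb' | hb'
    · rw [← mul_jordanMatrix_succ A _ j b hb', hA,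
        jordanMatrix_mul_of_lt A _ i a (by omega)] at h
      have := ih _ _ _ _ (by omega) h
      omega
    · omega

theorem jordanMatrix_pow_apply (m : ℕ) (p q : Σ i : Fin t, Fin (μ i)) :
    (jordanMatrix K t μ ^ m) p q = if p.1 = q.1 ∧ (p.2 : ℕ) + m = (q.2 : ℕ) then 1 else 0 := by
  induction m generalizing q with
  | zero =>
    obtain ⟨i, a⟩ := p
    obtain ⟨j, b⟩ := q
    rw [pow_zero, one_apply]
    congr 1
    rw [Sigma.mk.injEq]
    refine propext (and_congr_right ?_)
    rintro rfl
    simp [Fin.ext_iff]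
  | succ m ih =>
    obtain ⟨j, b, hb⟩ := q
    rw [pow_succ]
    cases b with
    | zero => simp [mul_jordanMatrix_zero]
    | succ b =>
      rw [mul_jordanMatrix_succ, ih]
      simp [← add_assoc]

theorem isNilpotent_jordanMatrix : IsNilpotent (jordanMatrix K t μ) := by
  refine ⟨∑ i, μ i, ?_⟩
  ext p q
  rw [jordanMatrix_pow_apply, if_neg, Matrix.zero_apply]
  rintro ⟨-, h⟩
  have := single_le_sum (f := μ) (fun i _ => Nat.zero_le _) (mem_univ q.1)
  have := q.2.2
  omega

theorem card_filter_sigma (P : (i : Fin t) → ℕ → Prop) [∀ i, DecidablePred (P i)] :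
    #{p : Σ i : Fin t, Fin (μ i) | P p.1 p.2} = ∑ i, #{a ∈ range (μ i) | P i a} := by
  rw [card_filter, Fintype.sum_sigma]
  refine sum_congr rfl fun i _ => ?_
  rw [card_filter, ← Fin.sum_univ_eq_sum_range (fun a => if P i a then 1 else 0)]

theorem rank_jordanMatrix_pow (m : ℕ) :
    (jordanMatrix K t μ ^ m).rank = ∑ i, (μ i - m) := by
  classical
  have hcard : #{p : Σ i : Fin t, Fin (μ i) | (p.2 : ℕ) + m < μ p.1} = ∑ i, (μ i - m) := by
    rw [card_filter_sigma (fun i a => a + m < μ i)]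
    refine sum_congr rfl fun i _ => ?_
    rw [show {a ∈ range (μ i) | a + m < μ i} = range (μ i - m) by ext; simp; omega, card_range]
  rw [← hcard]
  apply le_antisymm
  · refine rank_le_card_of_rows _ _ fun p q h => ?_
    rw [jordanMatrix_pow_apply] at h
    obtain ⟨h1, h2⟩ : p.1 = q.1 ∧ (p.2 : ℕ) + m = q.2 := by
      by_contra h'
      exact h (if_neg h')
    have := q.2.2
    rw [← h2, ← h1] at this
    exact mem_filter.mpr ⟨mem_univ _, this⟩
  · have h : jordanMatrix K t μ ^ m * (jordanMatrix K t μ ^ m)ᵀ =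
        diagonal fun p => if (p.2 : ℕ) + m < μ p.1 then 1 else 0 := by
      ext p q
      rw [mul_apply]
      simp only [transpose_apply, jordanMatrix_pow_apply, diagonal_apply]
      obtain ⟨i, a⟩ := p
      by_cases ha : (a : ℕ) + m < μ i
      · rw [sum_eq_single ⟨i, a + m, ha⟩]
        · obtain ⟨j, b⟩ := q
          by_cases hij : i = j
          · subst hij
            simp [ha, Fin.ext_iff, eq_comm]
          · have : ¬ j = i := fun h => hij h.symm
            simp [hij, this]
        · rintro ⟨j, b⟩ - hne
          rw [if_neg, zero_mul]
          rintro ⟨rfl : i = j, h2⟩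
          refine hne ?_
          congr 1
          ext
          simpa using h2.symm
        · simp
      · simp only [ha, if_false, ite_self]
        refine sum_eq_zero ?_
        rintro ⟨j, b⟩ -
        rw [if_neg, zero_mul]
        rintro ⟨rfl : i = j, h2⟩
        have := b.2
        simp only at h2
        omega
    have hr := rank_mul_le_left (jordanMatrix K t μ ^ m) (jordanMatrix K t μ ^ m)ᵀ
    rw [h, Matrix.rank_diagonal] at hr
    refine le_trans (le_of_eq ?_) hr
    rw [Fintype.card_subtype]
    congr 1
    ext p
    simp

end JordanMatrix

/-- Twice the position of a basis vector in its Jordan block, measured from the centre of the block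
(up to a constant). -/
def jordanWeight {t : ℕ} (μ : Fin t → ℕ) (p : Σ i : Fin t, Fin (μ i)) : ℤ :=
  2 * (p.2 : ℕ) - μ p.1

theorem card_almostRectangular_le {t : ℕ} {μ : Fin t → ℕ} {s : ℕ}
    (hs : ∀ i j : Fin t, i ≤ j → μ i ≤ μ j + 1 → (j : ℕ) - (i : ℕ) + 1 ≤ s)
    (S : Finset (Fin t)) (hS : ∀ i ∈ S, ∀ j ∈ S, μ i ≤ μ j + 1) : #S ≤ s := by
  rcases S.eq_empty_or_nonempty with rfl | hne
  · simp
  · have hsub : S ⊆ Finset.Icc (S.min' hne) (S.max' hne) := fun i hi =>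
      Finset.mem_Icc.mpr ⟨S.min'_le _ hi, S.le_max' _ hi⟩
    have h1 := card_le_card hsub
    have h2 := hs _ _ (S.min'_le_max' hne) (hS _ (S.min'_mem hne) _ (S.max'_mem hne))
    have h3 : (S.min' hne : ℕ) ≤ S.max' hne := S.min'_le_max' hne
    rw [Fin.card_Icc] at h1
    omega

theorem rank_pow_mul_le_of_commute_jordanMatrix {K : Type*} [Field K] {t : ℕ} {μ : Fin t → ℕ} {s : ℕ}
    (hs : ∀ i j : Fin t, i ≤ j → μ i ≤ μ j + 1 → (j : ℕ) - (i : ℕ) + 1 ≤ s)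
    {A : Matrix (Σ i : Fin t, Fin (μ i)) (Σ i : Fin t, Fin (μ i)) K}
    (hA : A * jordanMatrix K t μ = jordanMatrix K t μ * A) (hnil : IsNilpotent A) (m : ℕ) :
    (A ^ (s * m)).rank ≤ ∑ i, (μ i - m) := by
  classical
  let R : (Σ i : Fin t, Fin (μ i)) → (Σ i : Fin t, Fin (μ i)) → Prop := fun p q =>
    |(μ p.1 : ℤ) - μ q.1| ≤ jordanWeight μ q - jordanWeight μ p
  have hrefl : ∀ p, R p p := fun p => by simp [R]
  have htrans : ∀ p q u, R p q → R q u → R p u := fun p q u h1 h2 => by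
    have := abs_sub_le (μ p.1 : ℤ) (μ q.1) (μ u.1)
    simp only [R] at h1 h2 ⊢
    omega
  have hAR : ∀ p q, A p q ≠ 0 → R p q := by
    rintro ⟨i, a, ha⟩ ⟨j, b, hb⟩ h
    have h1 := le_of_commute_jordanMatrix hA _ _ _ _ _ _ h
    have h2 := add_le_add_of_commute_jordanMatrix hA i j (μ i - 1 - a) a b ha hb (by omega) h
    simp only [R, jordanWeight]
    rw [abs_le]
    constructor <;> omega
  have hraise : ∀ p q, (A ^ s) p q ≠ 0 → jordanWeight μ p + 2 ≤ jordanWeight μ q := by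
    intro p q h
    by_contra hlt
    refine h (pow_apply_eq_zero_of_card_interval_le R hrefl htrans hnil hAR p q s ?_)
    have hmem : ∀ u, R p u ∧ R u q → (μ u.1 = μ p.1 ∧ jordanWeight μ u = jordanWeight μ p) ∨
        (μ u.1 = μ q.1 ∧ jordanWeight μ u = jordanWeight μ q) := by
      rintro u ⟨h1, h2⟩
      simp only [R, abs_le] at h1 h2
      simp only [jordanWeight] at *
      omega
    have hinj : Set.InjOn Sigma.fst
        (({u | R p u ∧ R u q} : Finset (Σ i : Fin t, Fin (μ i))) :
          Set (Σ i : Fin t, Fin (μ i))) := by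
      rintro ⟨i, a⟩ hu ⟨i', b⟩ hv (rfl : i = i')
      have hu := (mem_filter.mp hu).2
      have hv := (mem_filter.mp hv).2
      have hu' := hmem _ hu
      have hv' := hmem _ hv
      have hpq : 0 ≤ jordanWeight μ q - jordanWeight μ p :=
        (abs_nonneg _).trans (htrans _ _ _ hu.1 hu.2)
      congr 1
      ext
      simp only [jordanWeight] at hu' hv' hpq hlt
      omega
    rw [← card_image_of_injOn hinj]
    apply card_almostRectangular_le hs
    intro i hi j hj
    obtain ⟨u, hu, rfl⟩ := mem_image.mp hi
    obtain ⟨v, hv, rfl⟩ := mem_image.mp hj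
    obtain ⟨-, hu⟩ := mem_filter.mp hu
    obtain ⟨-, hv⟩ := mem_filter.mp hv
    have hpq := htrans _ _ _ hu.1 hu.2
    have hu' := hmem _ hu
    have hv' := hmem _ hv
    simp only [R, abs_le] at hpq
    omega
  have hraise_pow : ∀ (m : ℕ) p q, ((A ^ s) ^ m) p q ≠ 0 →
      jordanWeight μ p + 2 * m ≤ jordanWeight μ q := by
    intro m
    induction m with
    | zero =>
      intro p q h
      by_cases hpq : p = q
      · simp [hpq]
      · simp [hpq] at h
    | succ m ih =>
      intro p q h
      rw [pow_succ, mul_apply] at h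
      obtain ⟨u, -, hu⟩ := exists_ne_zero_of_sum_ne_zero h
      have h1 := ih _ _ (left_ne_zero_of_mul hu)
      have h2 := hraise _ _ (right_ne_zero_of_mul hu)
      push_cast
      omega
  rw [pow_mul]
  refine (rank_le_card_add_card _ ({p | 2 * (p.2 : ℕ) + m + 1 ≤ μ p.1} : Finset _)
    ({q | μ q.1 + m ≤ 2 * (q.2 : ℕ)} : Finset _) ?_).trans (le_of_eq ?_)
  · intro p q h
    have := hraise_pow m p q h
    simp only [mem_filter, mem_univ, true_and, jordanWeight] at this ⊢
    omega
  · rw [card_filter_sigma (fun i a => 2 * a + m + 1 ≤ μ i),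
      card_filter_sigma (fun i a => μ i + m ≤ 2 * a), ← sum_add_distrib]
    refine sum_congr rfl fun i _ => ?_
    rw [show {a ∈ range (μ i) | 2 * a + m + 1 ≤ μ i} = range ((μ i - m + 1) / 2) by
        ext; simp; omega,
      show {a ∈ range (μ i) | μ i + m ≤ 2 * a} = Finset.Ico ((μ i + m + 1) / 2) (μ i) by
        ext; simp; omega,
      card_range, Nat.card_Ico]
    omega

/-- A convex sequence that is dominated at the multiples of `s` by a sequence whose drops between
two consecutive multiples of `s` take at most two consecutive values is dominated by it
everywhere. -/
theorem le_of_convex_of_le_mul {f g : ℕ → ℕ} {s : ℕ} (hs : 0 < s)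
    (hf : ∀ m, 2 * f (m + 1) ≤ f m + f (m + 2)) (hfg : ∀ j, f (s * j) ≤ g (s * j))
    (hg : ∀ j, ∃ d, ∀ m, s * j ≤ m → m < s * (j + 1) →
      g (m + 1) + d ≤ g m ∧ g m ≤ g (m + 1) + d + 1) (m : ℕ) : f m ≤ g m := by
  by_contra! hlt
  obtain ⟨d, hd⟩ := hg (m / s)
  have hm1 : s * (m / s) ≤ m := Nat.mul_div_le m s
  have hm2 : m < s * (m / s + 1) := Nat.lt_mul_div_succ m hs
  have h1 := hfg (m / s)
  have h2 := hfg (m / s + 1)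
  generalize s * (m / s) = l at *
  generalize s * (m / s + 1) = u at *
  have hconv : ∀ n k, (f (n + k) : ℤ) - f (n + k + 1) ≤ f n - f (n + 1) := by
    intro n k
    induction k with
    | zero => simp
    | succ k ih =>
      have := hf (n + k)
      rw [show n + (k + 1) = n + k + 1 from rfl, show n + k + 1 + 1 = n + k + 2 from rfl]
      omega
  rcases le_or_gt ((f m : ℤ) - f (m + 1)) d with h | h
  · have : ∀ k, m + k ≤ u → g (m + k) < f (m + k) := by
      intro k
      induction k with
      | zero => exact fun _ => hlt
      | succ k ih =>
        intro hk
        have h3 := ih (by omega)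
        have h4 := hd (m + k) (by omega) (by omega)
        have h5 := hconv m k
        rw [← add_assoc]
        omega
    have := this (u - m) (by omega)
    rw [show m + (u - m) = u by omega] at this
    omega
  · have : ∀ k, l + k ≤ m → g (m - k) < f (m - k) := by
      intro k
      induction k with
      | zero => exact fun _ => hlt
      | succ k ih =>
        intro hk
        have h3 := ih (by omega)
        have h4 := hd (m - (k + 1)) (by omega) (by omega)
        have h5 := hconv (m - (k + 1)) (k + 1)
        rw [show m - (k + 1) + 1 = m - k by omega] at h4 h5
        rw [show m - (k + 1) + (k + 1) = m by omega] at h5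
        omega
    have := this (m - l) (by omega)
    rw [show m - (m - l) = l by omega] at this
    omega

section Segments

variable {t s r : ℕ} {μ : Fin t → ℕ}

/-- The positions of the `k`-th segment when `Fin t` is cut into segments of length `s`. -/
def finSegment (t s k : ℕ) : Finset (Fin t) := {i | (i : ℕ) / s = k}

theorem mem_finSegment {k : ℕ} {i : Fin t} : i ∈ finSegment t s k ↔ (i : ℕ) / s = k := by
  simp [finSegment]

theorem card_finSegment_filter_le (hs : 0 < s) (i : Fin t) :
    #{j ∈ finSegment t s (i / s) | j ≤ i} = i % s + 1 := by
  have hdiv := Nat.div_add_mod (i : ℕ) s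
  have h : {j ∈ finSegment t s (i / s) | j ≤ i} = Finset.Icc ⟨s * (i / s), by omega⟩ i := by
    ext j
    rw [mem_filter, mem_finSegment, Finset.mem_Icc, Fin.le_def, Fin.le_def, Nat.div_eq_iff hs]
    rw [Nat.mul_comm (i / s) s]
    have := Nat.mod_lt i hs
    simp only
    omega
  rw [h, Fin.card_Icc]
  simp only
  omega

theorem card_finSegment (hs : 0 < s) (htr : t = s * r) {k : ℕ} (hk : k < r) :
    #(finSegment t s k) = s := by
  have hle : s * (k + 1) ≤ t := htr ▸ Nat.mul_le_mul_left s hk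
  rw [mul_add, mul_one] at hle
  let i : Fin t := ⟨s * k + (s - 1), by omega⟩
  have hi : (i : ℕ) / s = k := by
    rw [Nat.mul_add_div hs, Nat.div_eq_of_lt (by omega), add_zero]
  have hmod : (i : ℕ) % s = s - 1 := by
    rw [Nat.mul_add_mod, Nat.mod_eq_of_lt (by omega)]
  have h := card_finSegment_filter_le hs i
  rw [hi, hmod, filter_true_of_mem] at h
  · omega
  · intro j hj
    rw [mem_finSegment, Nat.div_eq_iff hs] at hj
    rw [Fin.le_def, show (i : ℕ) = s * k + (s - 1) from rfl, Nat.mul_comm s k]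
    omega

theorem sum_finSegment (htr : t = s * r) (f : Fin t → ℕ) :
    ∑ k : Fin r, ∑ i ∈ finSegment t s k, f i = ∑ i, f i := by
  have hlt : ∀ i : Fin t, (i : ℕ) / s < r := fun i =>
    Nat.div_lt_of_lt_mul (htr ▸ i.2)
  rw [← sum_fiberwise univ (fun i : Fin t => (⟨i / s, hlt i⟩ : Fin r)) f]
  refine sum_congr rfl fun k _ => sum_congr ?_ fun _ _ => rfl
  ext i
  simp [mem_finSegment, Fin.ext_iff]

theorem mul_add_mod_lt_sum_finSegment (hs : 0 < s) (htr : t = s * r)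
    (hmono : ∀ i j : Fin t, i ≤ j → μ j ≤ μ i)
    (hAR : ∀ i j : Fin t, (i : ℕ) / s = j / s → μ i ≤ μ j + 1)
    (i : Fin t) {a : ℕ} (ha : a < μ i) :
    s * a + i % s < ∑ j ∈ finSegment t s (i / s), μ j := by
  have hlt : (i : ℕ) / s < r := Nat.div_lt_of_lt_mul (htr ▸ i.2)
  have h1 : ∑ j ∈ finSegment t s (i / s), (a + if j ≤ i then 1 else 0) ≤
      ∑ j ∈ finSegment t s (i / s), μ j := by
    refine sum_le_sum fun j hj => ?_
    have h2 := hAR i j (mem_finSegment.mp hj).symm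
    split_ifs with hji
    · have := hmono j i hji
      omega
    · omega
  rw [sum_add_distrib, sum_const, card_finSegment hs htr hlt, ← card_filter,
    card_finSegment_filter_le hs, smul_eq_mul] at h1
  omega

theorem sum_finSegment_sub (hs : 0 < s) (htr : t = s * r)
    (hAR : ∀ i j : Fin t, (i : ℕ) / s = j / s → μ i ≤ μ j + 1) {k : ℕ} (hk : k < r) (m : ℕ) :
    ∑ i ∈ finSegment t s k, (μ i - m) = ∑ i ∈ finSegment t s k, μ i - s * m := by
  have hcard := card_finSegment hs htr hk
  have hconst : ∑ i ∈ finSegment t s k, m = s * m := by rw [sum_const, hcard, smul_eq_mul]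
  by_cases h : ∀ i ∈ finSegment t s k, m ≤ μ i
  · rw [← hconst]
    exact sum_tsub_distrib _ h
  · push Not at h
    obtain ⟨i, hi, him⟩ := h
    have hle : ∀ j ∈ finSegment t s k, μ j ≤ m := fun j hj => by
      have := hAR j i ((mem_finSegment.mp hj).trans (mem_finSegment.mp hi).symm)
      omega
    have h1 := sum_le_sum hle
    rw [hconst] at h1
    rw [Nat.sub_eq_zero_of_le h1]
    exact sum_eq_zero fun j hj => Nat.sub_eq_zero_of_le (hle j hj)

theorem exists_sum_finSegment_drop (hs : 0 < s) (htr : t = s * r)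
    (hAR : ∀ i j : Fin t, (i : ℕ) / s = j / s → μ i ≤ μ j + 1)
    (hgap : ∀ i j : Fin t, (i : ℕ) / s < j / s → ∃ i' : Fin t, (i' : ℕ) / s = i / s ∧
      μ j + 2 ≤ μ i') (j : ℕ) :
    ∃ d, ∀ m, s * j ≤ m → m < s * (j + 1) →
      ∑ k : Fin r, (∑ i ∈ finSegment t s k, μ i - (m + 1)) + d ≤
        ∑ k : Fin r, (∑ i ∈ finSegment t s k, μ i - m) ∧
      ∑ k : Fin r, (∑ i ∈ finSegment t s k, μ i - m) ≤
        ∑ k : Fin r, (∑ i ∈ finSegment t s k, μ i - (m + 1)) + d + 1 := by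
  obtain ⟨M, hM⟩ : ∃ M : Fin r → ℕ, ∀ k : Fin r, ∑ i ∈ finSegment t s k, μ i = M k :=
    ⟨_, fun _ => rfl⟩
  simp only [hM]
  have hconst : ∀ (k : Fin r) n, ∑ i ∈ finSegment t s k, n = s * n := fun k n => by
    rw [sum_const, card_finSegment hs htr k.2, smul_eq_mul]
  have hlarge : ∀ k, s * j < M k → ∃ i ∈ finSegment t s k, j < μ i := by
    intro k h1
    by_contra! h
    have := sum_le_sum h
    rw [hconst, hM] at this
    omega
  have hsmall : ∀ k, M k < s * (j + 1) → ∃ i ∈ finSegment t s k, μ i < j + 1 := by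
    intro k h2
    by_contra! h
    have := sum_le_sum h
    rw [hconst, hM] at this
    omega
  have huniq : #{k | s * j < M k ∧ M k < s * (j + 1)} ≤ 1 := by
    have hlt : ∀ k l : Fin r, k < l → M k < s * (j + 1) → s * j < M l → False := by
      intro k l hkl h2 h3
      obtain ⟨i, hi, hij⟩ := hsmall k h2
      obtain ⟨i', hi', hij'⟩ := hlarge l h3
      rw [mem_finSegment] at hi hi'
      obtain ⟨i'', h4, h5⟩ := hgap i i' (by rw [hi, hi']; exact hkl)
      have := hAR i'' i h4
      omega
    rw [card_le_one]
    intro k hk l hl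
    simp only [mem_filter, mem_univ, true_and] at hk hl
    rcases lt_trichotomy k l with h | h | h
    · exact (hlt k l h hk.2 hl.1).elim
    · exact h
    · exact (hlt l k h hl.2 hk.1).elim
  refine ⟨#{k | s * (j + 1) ≤ M k}, fun m hm1 hm2 => ⟨?_, ?_⟩⟩
  · rw [card_filter, ← sum_add_distrib]
    refine sum_le_sum fun k _ => ?_
    split_ifs <;> omega
  · refine le_trans ?_ (Nat.add_le_add_left huniq _)
    rw [card_filter, card_filter, ← sum_add_distrib, ← sum_add_distrib]
    refine sum_le_sum fun k _ => ?_
    split_ifs <;> omega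

theorem exists_regular_commuting (K : Type*) [Field K] (hs : 0 < s) (htr : t = s * r)
    (hmono : ∀ i j : Fin t, i ≤ j → μ j ≤ μ i)
    (hAR : ∀ i j : Fin t, (i : ℕ) / s = j / s → μ i ≤ μ j + 1) :
    ∃ A : Matrix (Σ i : Fin t, Fin (μ i)) (Σ i : Fin t, Fin (μ i)) K,
      A * jordanMatrix K t μ = jordanMatrix K t μ * A ∧ IsNilpotent A ∧
      ∀ m : ℕ, (A ^ m).rank = ∑ k : Fin r, (∑ i ∈ finSegment t s k, μ i - m) := by
  let M : Fin r → ℕ := fun k => ∑ i ∈ finSegment t s k, μ i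
  let f : (Σ i : Fin t, Fin (μ i)) → Σ k : Fin r, Fin (M k) := fun p =>
    ⟨⟨p.1 / s, Nat.div_lt_of_lt_mul (htr ▸ p.1.2)⟩, s * p.2 + p.1 % s,
      mul_add_mod_lt_sum_finSegment hs htr hmono hAR p.1 p.2.2⟩
  have hf : ∀ p q n, ((f p).1 = (f q).1 ∧ ((f p).2 : ℕ) + s * n = (f q).2) ↔
      (p.1 = q.1 ∧ (p.2 : ℕ) + n = q.2) := by
    intro p q n
    simp only [f, Fin.mk.injEq]
    constructor
    · rintro ⟨h1, h2⟩
      have h3 := congrArg (· % s) h2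
      have h4 := congrArg (· / s) h2
      rw [show s * (p.2 : ℕ) + p.1 % s + s * n = s * ((p.2 : ℕ) + n) + p.1 % s by ring] at h3 h4
      simp only [Nat.mul_add_mod, Nat.mod_mod, Nat.mul_add_div hs,
        Nat.div_eq_of_lt (Nat.mod_lt _ hs), add_zero] at h3 h4
      refine ⟨Fin.ext ?_, h4⟩
      rw [← Nat.div_add_mod (p.1 : ℕ) s, h1, h3, Nat.div_add_mod]
    · rintro ⟨h1, h2⟩
      rw [← h2, ← h1]
      exact ⟨rfl, by ring⟩
  have hinj : Function.Injective f := by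
    intro p q h
    have h0 := (hf p q 0).mp (by rw [h]; simp)
    obtain ⟨i, a⟩ := p
    obtain ⟨j, b⟩ := q
    obtain ⟨rfl : i = j, h2⟩ := h0
    congr 1
    exact Fin.ext h2
  have hbij : Function.Bijective f := by
    rw [Fintype.bijective_iff_injective_and_card]
    refine ⟨hinj, ?_⟩
    simp only [Fintype.card_sigma, Fintype.card_fin, M]
    exact (sum_finSegment htr μ).symm
  let e := Equiv.ofBijective f hbij
  let φ := reindexAlgEquiv K K e.symm
  have hφ : ∀ m, φ (jordanMatrix K r M ^ m) = φ (jordanMatrix K r M) ^ m := map_pow φ _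
  have hJ : φ (jordanMatrix K r M ^ s) = jordanMatrix K t μ := by
    ext p q
    have : φ (jordanMatrix K r M ^ s) p q = (jordanMatrix K r M ^ s) (f p) (f q) := rfl
    rw [this, jordanMatrix_pow_apply]
    have h1 := hf p q 1
    rw [mul_one] at h1
    rw [jordanMatrix]
    simp only [h1]
  refine ⟨φ (jordanMatrix K r M), ?_, isNilpotent_jordanMatrix.map φ, fun m => ?_⟩
  · rw [← hJ, hφ, ← pow_succ, ← pow_succ']
  · rw [← hφ, ← rank_jordanMatrix_pow (K := K) (μ := M) m]
    exact rank_reindex _ _ _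

end Segments

/-- Suppose `K` is infinite. Let `0 = c_0 < c_1 < ... < c_r = t` be the greedy segmentation of
`B = (μ_1 ≥ ... ≥ μ_t)` into almost rectangular segments (each segment is almost rectangular,
and no segment can be extended: the part right after a segment is smaller by at least `2` than
the first part of the segment), where `r = r_B`.  Set `μ̃_k = μ_{c_k + 1} + ... + μ_{c_{k+1}}`
and `B̃ = (μ̃_1, ..., μ̃_r)`.  If `s_B = c_{k+1} - c_k` for every `k`, then `Q(B) = B̃`:
some nilpotent `A₀` commuting with `J` has Jordan type `B̃` (i.e. the rank sequence of `A₀` is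
that of a nilpotent matrix with Jordan blocks `μ̃_1, ..., μ̃_r`), and every nilpotent `A`
commuting with `J` satisfies `rank A^m ≤ Σ_k (μ̃_k - m)` `(= rank J̃^m)` for all `m`. -/
theorem QB_eq_tildeB
    (K : Type*) [Field K] [Infinite K]
    (t : ℕ) (μ : Fin t → ℕ) (hpos : ∀ i, 0 < μ i)
    (hmono : ∀ i j : Fin t, i ≤ j → μ j ≤ μ i)
    (s : ℕ)
    (hs : IsGreatest {d : ℕ | ∃ i j : Fin t, i ≤ j ∧ μ i ≤ μ j + 1 ∧
      d = (j : ℕ) - (i : ℕ) + 1} s)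
    (r : ℕ) (c : Fin (r + 1) → ℕ)
    (hc0 : c 0 = 0) (hct : c (Fin.last r) = t) (hcmono : StrictMono c)
    (hAR : ∀ k : Fin r, ∀ i j : Fin t,
      c k.castSucc ≤ (i : ℕ) → (i : ℕ) < c k.succ →
      c k.castSucc ≤ (j : ℕ) → (j : ℕ) < c k.succ → μ i ≤ μ j + 1)
    (hgreedy : ∀ k : Fin r, ∀ (h1 : c k.castSucc < t) (h2 : c k.succ < t),
      μ ⟨c k.succ, h2⟩ + 2 ≤ μ ⟨c k.castSucc, h1⟩)
    (hseg : ∀ k : Fin r, c k.succ - c k.castSucc = s) :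
    (∃ A₀ : Matrix (Σ i : Fin t, Fin (μ i)) (Σ i : Fin t, Fin (μ i)) K,
        A₀ * jordanMatrix K t μ = jordanMatrix K t μ * A₀ ∧ IsNilpotent A₀ ∧
        ∀ m : ℕ, (A₀ ^ m).rank =
          ∑ k : Fin r,
            ((∑ i ∈ univ.filter (fun i : Fin t =>
                c k.castSucc ≤ (i : ℕ) ∧ (i : ℕ) < c k.succ), μ i) - m)) ∧
    (∀ A : Matrix (Σ i : Fin t, Fin (μ i)) (Σ i : Fin t, Fin (μ i)) K,
        A * jordanMatrix K t μ = jordanMatrix K t μ * A → IsNilpotent A →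
        ∀ m : ℕ, (A ^ m).rank ≤
          ∑ k : Fin r,
            ((∑ i ∈ univ.filter (fun i : Fin t =>
                c k.castSucc ≤ (i : ℕ) ∧ (i : ℕ) < c k.succ), μ i) - m)) := by
  have hs0 : 0 < s := by
    obtain ⟨i, j, -, -, h⟩ := hs.1
    omega
  have hc : ∀ k : Fin (r + 1), c k = s * k := by
    intro k
    induction k using Fin.induction with
    | zero => simpa using hc0
    | succ k ih =>
      have h1 := hseg k
      rw [Fin.val_succ, mul_add, mul_one]
      rw [Fin.val_castSucc] at ih
      omega
  have htr : t = s * r := by rw [← hct, hc, Fin.val_last]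
  have hmem : ∀ (k : Fin r) (i : Fin t), (c k.castSucc ≤ (i : ℕ) ∧ (i : ℕ) < c k.succ) ↔
      (i : ℕ) / s = k := by
    intro k i
    rw [hc, hc, Nat.div_eq_iff hs0, Fin.val_succ, Fin.val_castSucc, mul_add, mul_one,
      Nat.mul_comm s k]
    omega
  have hsegment : ∀ k : Fin r, univ.filter (fun i : Fin t =>
      c k.castSucc ≤ (i : ℕ) ∧ (i : ℕ) < c k.succ) = finSegment t s k := by
    intro k
    ext i
    rw [mem_filter, hmem, mem_finSegment]
    simp
  simp only [hsegment]
  have hlt : ∀ i : Fin t, (i : ℕ) / s < r := fun i => Nat.div_lt_of_lt_mul (htr ▸ i.2)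
  have hAR' : ∀ i j : Fin t, (i : ℕ) / s = j / s → μ i ≤ μ j + 1 := by
    intro i j hij
    obtain ⟨h1, h2⟩ := (hmem ⟨i / s, hlt i⟩ i).mpr rfl
    obtain ⟨h3, h4⟩ := (hmem ⟨i / s, hlt i⟩ j).mpr hij.symm
    exact hAR _ i j h1 h2 h3 h4
  have hgap : ∀ i j : Fin t, (i : ℕ) / s < j / s → ∃ i' : Fin t, (i' : ℕ) / s = i / s ∧
      μ j + 2 ≤ μ i' := by
    intro i j hij
    let k : Fin r := ⟨i / s, hlt i⟩
    have hj : c k.succ ≤ j := by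
      rw [hc]
      exact (Nat.mul_le_mul_left s hij).trans (Nat.mul_div_le j s)
    have hk := hcmono k.castSucc_lt_succ
    have h2 : c k.succ < t := hj.trans_lt j.2
    have h1 : c k.castSucc < t := hk.trans h2
    refine ⟨⟨c k.castSucc, h1⟩, (hmem k ⟨c k.castSucc, h1⟩).mp ⟨le_rfl, hk⟩, ?_⟩
    exact (Nat.add_le_add_right (hmono ⟨c k.succ, h2⟩ j hj) 2).trans (hgreedy k h1 h2)
  refine ⟨exists_regular_commuting K hs0 htr hmono hAR', fun A hA hnil m => ?_⟩
  refine le_of_convex_of_le_mul (f := fun m => (A ^ m).rank)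
    (g := fun m => ∑ k : Fin r, (∑ i ∈ finSegment t s k, μ i - m)) hs0 A.rank_pow_convex
    (fun j => ?_) (exists_sum_finSegment_drop hs0 htr hAR' hgap) m
  refine (rank_pow_mul_le_of_commute_jordanMatrix
    (fun i j hij hμ => hs.2 ⟨i, j, hij, hμ, rfl⟩) hA hnil j).trans (le_of_eq ?_)
  rw [← sum_finSegment htr]
  exact sum_congr rfl fun k _ => sum_finSegment_sub hs0 htr hAR' k.2 j
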